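/- arXiv:2603.16833 — 5 statements merged into one kernel-verified Lean document; each statement's English description precedes it below -/
import Mathlib

section
/- Surrogate-mediated MAR identifies the full conditional outcome mean: if Δ and Y are conditionally independent given 𝔪 and gΔ ≥ cΔ almost surely for some constant cΔ > 0, then the observed-data outcome regression Q̄ equals E[Y | 𝔪] almost surely. -/
open MeasureTheory ProbabilityTheory

/-- Conditionally independent random variables with countably generated target spaces are almost
surely independent under the conditional expectation kernel. -/
theorem ProbabilityTheory.CondIndepFun.ae_indepFun_condExpKernel
    {Ω β γ : Type*} {m mΩ : MeasurableSpace Ω} [StandardBorelSpace Ω] {hm : m ≤ mΩ}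
    {μ : Measure Ω} [IsFiniteMeasure μ] {mβ : MeasurableSpace β} {mγ : MeasurableSpace γ}
    [MeasurableSpace.CountableOrCountablyGenerated Ω (β × γ)] {f : Ω → β} {g : Ω → γ}
    (h : CondIndepFun m hm f g μ) (hf : Measurable f) (hg : Measurable g) :
    ∀ᵐ ω ∂μ, IndepFun f g (condExpKernel μ m ω) := by
  filter_upwards [ae_of_ae_trim hm ((condIndepFun_iff_map_prod_eq_prod_map_map hf hg).1 h)]
    with ω hω
  rw [indepFun_iff_map_prod_eq_prod_map_map hf.aemeasurable hg.aemeasurable]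
  rwa [Kernel.map_apply _ (hf.prodMk hg), Kernel.prod_apply, Kernel.map_apply _ hf,
    Kernel.map_apply _ hg] at hω

/-- The conditional expectation of a product of conditionally independent real random variables
is the product of their conditional expectations. -/
theorem ProbabilityTheory.CondIndepFun.condExp_mul
    {Ω : Type*} {m mΩ : MeasurableSpace Ω} [StandardBorelSpace Ω] {hm : m ≤ mΩ}
    {μ : Measure Ω} [IsFiniteMeasure μ] {f g : Ω → ℝ}
    (h : CondIndepFun m hm f g μ) (hf : Measurable f) (hg : Measurable g)
    (hf_int : Integrable f μ) (hg_int : Integrable g μ)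
    (hfg_int : Integrable (fun ω => f ω * g ω) μ) :
    μ[fun ω => f ω * g ω | m] =ᵐ[μ] fun ω => (μ[f | m]) ω * (μ[g | m]) ω := by
  filter_upwards [h.ae_indepFun_condExpKernel hf hg,
    condExp_ae_eq_integral_condExpKernel hm hf_int,
    condExp_ae_eq_integral_condExpKernel hm hg_int,
    condExp_ae_eq_integral_condExpKernel hm hfg_int] with ω hω h₁ h₂ h₃
  rw [h₁, h₂, h₃]
  exact hω.integral_fun_mul_eq_mul_integral hf.aestronglyMeasurable hg.aestronglyMeasurable

/-- **Surrogate-mediated MAR identifies the full conditional outcome mean.**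
With `𝔪 := σ(S, A, W)`, let `gΔ` be a version of `E[Δ | 𝔪]`.  If `Δ` and `Y` are
conditionally independent given `𝔪` and `gΔ ≥ cΔ` almost surely for some constant
`cΔ > 0`, then the observed-data outcome regression `Q̄ := E[Δ·Y | 𝔪] / gΔ` equals
`E[Y | 𝔪]` almost surely. -/
theorem surrogate_MAR_identifies_regression
    {Ω : Type*} [mΩ : MeasurableSpace Ω] [StandardBorelSpace Ω]
    {P : Measure Ω} [IsProbabilityMeasure P] {p : ℕ}
    (W : Ω → (Fin p → ℝ)) (A S Δ Y : Ω → ℝ)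
    (hW : Measurable W) (hA : Measurable A) (hS : Measurable S)
    (hΔ : Measurable Δ) (hY : Measurable Y)
    (hA01 : ∀ ω, A ω = 0 ∨ A ω = 1) (hΔ01 : ∀ ω, Δ ω = 0 ∨ Δ ω = 1)
    (𝔪 : MeasurableSpace Ω)
    (h𝔪 : 𝔪 = MeasurableSpace.comap (fun ω => (S ω, A ω, W ω)) inferInstance)
    (h𝔪le : 𝔪 ≤ mΩ)
    (hCI : CondIndepFun 𝔪 h𝔪le Δ Y P)
    (hYint : Integrable Y P)
    (hΔYint : Integrable (fun ω => Δ ω * Y ω) P)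
    (gΔ : Ω → ℝ) (hgΔ : gΔ =ᵐ[P] P[Δ | 𝔪])
    (cΔ : ℝ) (hcΔ : 0 < cΔ) (hgΔpos : ∀ᵐ ω ∂P, cΔ ≤ gΔ ω) :
    (fun ω => (P[fun ω' => Δ ω' * Y ω' | 𝔪]) ω / gΔ ω) =ᵐ[P] P[Y | 𝔪] := by
  have hΔint : Integrable Δ P := by
    refine Integrable.of_bound hΔ.aestronglyMeasurable 1 (ae_of_all _ fun ω => ?_)
    rcases hΔ01 ω with h | h <;> simp [h]
  filter_upwards [hCI.condExp_mul hΔ hY hΔint hYint hΔYint, hgΔ, hgΔpos] with ω hmul hg hpos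
  rw [hmul, ← hg, mul_div_cancel_left₀ _ (hcΔ.trans_le hpos).ne']
end

section
/- Inverse-propensity identification of the arm-1 counterfactual mean (the ignorability step in the proof of Theorem 1): if A is conditionally independent of Y(1) given 𝔴 and e ≥ cA almost surely for some constant cA > 0, then E[(A / e) · Y(1)] = E[Y(1)]. -/
open MeasureTheory ProbabilityTheory

/-- The conditional expectation of a product of conditionally independent real random variables
is the product of the conditional expectations. -/
theorem condExp_mul_of_condIndepFun {Ω : Type*} {m mΩ : MeasurableSpace Ω} [StandardBorelSpace Ω]
    {μ : Measure Ω} [IsFiniteMeasure μ] {X Y : Ω → ℝ} (hm : m ≤ mΩ)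
    (hXY : CondIndepFun m hm X Y μ) (hX : Measurable X) (hY : Measurable Y)
    (hX_int : Integrable X μ) (hY_int : Integrable Y μ) (hXY_int : Integrable (X * Y) μ) :
    μ[X * Y | m] =ᵐ[μ] μ[X | m] * μ[Y | m] := by
  have h := ae_of_ae_trim hm ((condIndepFun_iff_map_prod_eq_prod_map_map hX hY).1 hXY)
  filter_upwards [h, condExp_ae_eq_integral_condExpKernel hm hX_int,
    condExp_ae_eq_integral_condExpKernel hm hY_int,
    condExp_ae_eq_integral_condExpKernel hm hXY_int] with ω hω hXω hYω hXYω
  have hind : IndepFun X Y (condExpKernel μ m ω) := by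
    rw [indepFun_iff_map_prod_eq_prod_map_map hX.aemeasurable hY.aemeasurable]
    rwa [Kernel.map_apply _ (hX.prodMk hY), Kernel.prod_apply, Kernel.map_apply _ hX,
      Kernel.map_apply _ hY] at hω
  rw [Pi.mul_apply, hXω, hYω, hXYω]
  exact hind.integral_mul_eq_mul_integral hX.aestronglyMeasurable hY.aestronglyMeasurable

/-- **Inverse-propensity identification of the arm-1 counterfactual mean** (the
ignorability step in the proof of Theorem 1).  With `𝔴 := σ(W)` and `e` a version of
`E[A | 𝔴]`, if `A` is conditionally independent of the integrable counterfactual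
outcome `Y(1)` given `𝔴` (Mathlib's `CondIndepFun`) and `e ≥ cA` almost surely for
some constant `cA > 0`, then `E[(A / e) · Y(1)] = E[Y(1)]`. -/
theorem ipw_identifies_counterfactual_mean
    {Ω : Type*} [mΩ : MeasurableSpace Ω] [StandardBorelSpace Ω]
    {P : Measure Ω} [IsProbabilityMeasure P] {p : ℕ}
    (W : Ω → (Fin p → ℝ)) (A Y1 : Ω → ℝ)
    (hW : Measurable W) (hA : Measurable A) (hY1 : Measurable Y1)
    (hA01 : ∀ ω, A ω = 0 ∨ A ω = 1)
    (𝔴 : MeasurableSpace Ω)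
    (h𝔴 : 𝔴 = MeasurableSpace.comap W inferInstance)
    (h𝔴le : 𝔴 ≤ mΩ)
    (hCI : CondIndepFun 𝔴 h𝔴le A Y1 P)
    (hY1int : Integrable Y1 P)
    (e : Ω → ℝ) (he : e =ᵐ[P] P[A | 𝔴])
    (cA : ℝ) (hcA : 0 < cA) (hepos : ∀ᵐ ω ∂P, cA ≤ e ω) :
    ∫ ω, (A ω / e ω) * Y1 ω ∂P = ∫ ω, Y1 ω ∂P := by
  have hA_bound : ∀ᵐ ω ∂P, ‖A ω‖ ≤ 1 :=
    ae_of_all _ fun ω ↦ by rcases hA01 ω with h | h <;> simp [h]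
  have hA_int : Integrable A P := .of_bound hA.aestronglyMeasurable 1 hA_bound
  have hAY_int : Integrable (A * Y1) P :=
    hY1int.bdd_mul hA.aestronglyMeasurable hA_bound
  have he_inv : AEStronglyMeasurable[𝔴] e⁻¹ P :=
    ⟨(P[A | 𝔴])⁻¹, stronglyMeasurable_condExp.measurable.inv.stronglyMeasurable, he.inv⟩
  have he_bound : ∀ᵐ ω ∂P, ‖e⁻¹ ω‖ ≤ cA⁻¹ := by
    filter_upwards [hepos] with ω hω
    rw [Pi.inv_apply, norm_inv, Real.norm_of_nonneg (hcA.le.trans hω)]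
    gcongr
  have hce : P[e⁻¹ * (A * Y1) | 𝔴] =ᵐ[P] P[Y1 | 𝔴] := by
    filter_upwards [condExp_stronglyMeasurable_mul_of_bound₀ h𝔴le he_inv hAY_int _ he_bound,
      condExp_mul_of_condIndepFun h𝔴le hCI hA hY1 hA_int hY1int hAY_int, he, hepos]
      with ω h₁ h₂ h₃ h₄
    rw [h₁, Pi.mul_apply, h₂, Pi.mul_apply, ← h₃, Pi.inv_apply,
      inv_mul_cancel_left₀ (hcA.trans_le h₄).ne']
  calc ∫ ω, (A ω / e ω) * Y1 ω ∂P = ∫ ω, (e⁻¹ * (A * Y1)) ω ∂P := by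
        congr with ω
        simp only [Pi.mul_apply, Pi.inv_apply]
        ring
    _ = ∫ ω, P[e⁻¹ * (A * Y1) | 𝔴] ω ∂P := (integral_condExp h𝔴le).symm
    _ = ∫ ω, P[Y1 | 𝔴] ω ∂P := integral_congr_ae hce
    _ = ∫ ω, Y1 ω ∂P := integral_condExp h𝔴le
end

section
/- Product-weight (AIPW-type) identification under both positivity boundaries: under consistency, ignorability, surrogate-mediated MAR, treatment positivity, and censoring support positivity, E[(A·Δ) / (e·gΔ) · Y] = E[Y(1)]. -/
open MeasureTheory ProbabilityTheory

/-- For conditionally independent real random variables, the conditional expectation of the product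
is the product of the conditional expectations. -/
theorem condExp_mul_of_condIndepFun_s3
    {Ω : Type*} {m mΩ : MeasurableSpace Ω} [StandardBorelSpace Ω]
    {μ : Measure Ω} [IsFiniteMeasure μ] {hm : m ≤ mΩ} {f g : Ω → ℝ}
    (hf : Measurable f) (hg : Measurable g) (hfg : CondIndepFun m hm f g μ)
    (hfi : Integrable f μ) (hgi : Integrable g μ) (hfgi : Integrable (f * g) μ) :
    μ[f * g | m] =ᵐ[μ] μ[f | m] * μ[g | m] := by
  filter_upwards [ae_of_ae_trim hm ((condIndepFun_iff_map_prod_eq_prod_map_map hf hg).1 hfg),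
    condExp_ae_eq_integral_condExpKernel hm hfi, condExp_ae_eq_integral_condExpKernel hm hgi,
    condExp_ae_eq_integral_condExpKernel hm hfgi] with ω hω hfω hgω hfgω
  rw [Kernel.map_apply _ (hf.prodMk hg), Kernel.prod_apply, Kernel.map_apply _ hf,
    Kernel.map_apply _ hg] at hω
  rw [Pi.mul_apply, hfω, hgω, hfgω]
  exact ((indepFun_iff_map_prod_eq_prod_map_map hf.aemeasurable hg.aemeasurable).2
    hω).integral_mul_eq_mul_integral hf.aestronglyMeasurable hg.aestronglyMeasurable

/-- If `f` and `g` are conditionally independent given `m`, then `f` may be replaced by its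
conditional expectation under the integral against `g` weighted by an `m`-measurable function. -/
theorem integral_mul_mul_eq_integral_mul_condExp_mul
    {Ω : Type*} {m mΩ : MeasurableSpace Ω} [StandardBorelSpace Ω]
    {μ : Measure Ω} [IsFiniteMeasure μ] {hm : m ≤ mΩ} {f g h : Ω → ℝ} {C R : ℝ}
    (hf : Measurable f) (hg : Measurable g) (hfg : CondIndepFun m hm f g μ)
    (hgi : Integrable g μ) (hfR : ∀ᵐ ω ∂μ, |f ω| ≤ R)
    (hh : AEStronglyMeasurable[m] h μ) (hhC : ∀ᵐ ω ∂μ, |h ω| ≤ C) :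
    ∫ ω, h ω * (f ω * g ω) ∂μ = ∫ ω, h ω * (μ[f | m] ω * g ω) ∂μ := by
  have hfi : Integrable f μ := .of_bound hf.aestronglyMeasurable R hfR
  have hfgi : Integrable (f * g) μ := hgi.bdd_mul hf.aestronglyMeasurable hfR
  have hEgi : Integrable (μ[f | m] * g) μ :=
    hgi.bdd_mul integrable_condExp.aestronglyMeasurable (ae_bdd_abs_condExp_of_ae_bdd_abs hfR)
  have key : μ[f * g | m] =ᵐ[μ] μ[μ[f | m] * g | m] :=
    (condExp_mul_of_condIndepFun_s3 hf hg hfg hfi hgi hfgi).trans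
      (condExp_mul_of_stronglyMeasurable_left stronglyMeasurable_condExp hEgi hgi).symm
  have pull {k : Ω → ℝ} (hk : Integrable k μ) :
      ∫ ω, h ω * k ω ∂μ = ∫ ω, h ω * μ[k | m] ω ∂μ := by
    have hhk : Integrable (h * k) μ := hk.bdd_mul (hh.mono hm) hhC
    rw [← integral_condExp hm (f := fun ω => h ω * k ω)]
    exact integral_congr_ae (condExp_mul_of_aestronglyMeasurable_left hh hhk hk)
  refine (pull hfgi).trans (Eq.trans (integral_congr_ae ?_) (pull hEgi).symm)
  filter_upwards [key] with ω hω
  rw [hω]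

/-- **Product-weight (AIPW-type) identification under both positivity boundaries.**
With `𝔪 := σ(S, A, W)`, `𝔴 := σ(W)`, `gΔ` a version of `E[Δ | 𝔪]` and `e` a version
of `E[A | 𝔴]`, under consistency `Y = A·Y(1) + (1−A)·Y(0)`, ignorability
`A ⫫ (Y(0), Y(1)) | 𝔴`, surrogate-mediated MAR `Δ ⫫ Y | 𝔪`, treatment positivity
`cA ≤ e ≤ 1 − cA` a.s., and censoring support positivity `gΔ ≥ cΔ > 0` a.s., one has
`E[(A·Δ) / (e·gΔ) · Y] = E[Y(1)]`. -/
theorem product_weight_identification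
    {Ω : Type*} [mΩ : MeasurableSpace Ω] [StandardBorelSpace Ω]
    {P : Measure Ω} [IsProbabilityMeasure P] {p : ℕ}
    (W : Ω → (Fin p → ℝ)) (A S Δ Y Y0 Y1 : Ω → ℝ)
    (hW : Measurable W) (hA : Measurable A) (hS : Measurable S)
    (hΔ : Measurable Δ) (hY : Measurable Y)
    (hY0 : Measurable Y0) (hY1 : Measurable Y1)
    (hA01 : ∀ ω, A ω = 0 ∨ A ω = 1) (hΔ01 : ∀ ω, Δ ω = 0 ∨ Δ ω = 1)
    (𝔪 𝔴 : MeasurableSpace Ω)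
    (h𝔪 : 𝔪 = MeasurableSpace.comap (fun ω => (S ω, A ω, W ω)) inferInstance)
    (h𝔴 : 𝔴 = MeasurableSpace.comap W inferInstance)
    (h𝔪le : 𝔪 ≤ mΩ) (h𝔴le : 𝔴 ≤ mΩ)
    -- consistency
    (hcons : ∀ ω, Y ω = A ω * Y1 ω + (1 - A ω) * Y0 ω)
    -- ignorability
    (hign : CondIndepFun 𝔴 h𝔴le A (fun ω => (Y0 ω, Y1 ω)) P)
    -- surrogate-mediated MAR
    (hMAR : CondIndepFun 𝔪 h𝔪le Δ Y P)
    (hY0int : Integrable Y0 P) (hY1int : Integrable Y1 P) (hYint : Integrable Y P)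
    (gΔ : Ω → ℝ) (hgΔ : gΔ =ᵐ[P] P[Δ | 𝔪])
    (e : Ω → ℝ) (he : e =ᵐ[P] P[A | 𝔴])
    -- treatment positivity
    (cA : ℝ) (hcA : 0 < cA) (hepos : ∀ᵐ ω ∂P, cA ≤ e ω ∧ e ω ≤ 1 - cA)
    -- censoring support positivity
    (cΔ : ℝ) (hcΔ : 0 < cΔ) (hgΔpos : ∀ᵐ ω ∂P, cΔ ≤ gΔ ω) :
    ∫ ω, (A ω * Δ ω) / (e ω * gΔ ω) * Y ω ∂P = ∫ ω, Y1 ω ∂P := by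
  have hA1 (ω : Ω) : |A ω| ≤ 1 := by rcases hA01 ω with h | h <;> simp [h]
  have hΔ1 (ω : Ω) : |Δ ω| ≤ 1 := by rcases hΔ01 ω with h | h <;> simp [h]
  have hXm : Measurable[𝔪] fun ω => (S ω, A ω, W ω) := by
    rw [h𝔪]; exact comap_measurable _
  have h𝔴𝔪 : 𝔴 ≤ 𝔪 := by
    rw [h𝔴]; exact hXm.snd.snd.comap_le
  have hAm : StronglyMeasurable[𝔪] A := hXm.snd.fst.stronglyMeasurable
  have hew : AEStronglyMeasurable[𝔴] e P :=
    stronglyMeasurable_condExp.aestronglyMeasurable.congr he.symm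
  have hgm : AEStronglyMeasurable[𝔪] gΔ P :=
    stronglyMeasurable_condExp.aestronglyMeasurable.congr hgΔ.symm
  have hem : AEStronglyMeasurable[𝔪] e P := hew.mono h𝔴𝔪
  have hAY (ω : Ω) : A ω * Y ω = A ω * Y1 ω := by
    rcases hA01 ω with h | h <;> simp [hcons ω, h]
  have hind : CondIndepFun 𝔴 h𝔴le A Y1 P := hign.comp measurable_id measurable_snd
  have censoring := integral_mul_mul_eq_integral_mul_condExp_mul hΔ hY hMAR hYint
    (.of_forall hΔ1) (h := fun ω => A ω * (e ω * gΔ ω)⁻¹) (C := (cA * cΔ)⁻¹)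
    (hAm.aestronglyMeasurable.mul (hem.mul hgm).inv₀) (by
      filter_upwards [hepos, hgΔpos] with ω h1 h2
      have h3 : cA * cΔ ≤ e ω * gΔ ω := mul_le_mul h1.1 h2 hcΔ.le (hcA.le.trans h1.1)
      have h4 : 0 < cA * cΔ := mul_pos hcA hcΔ
      rw [abs_mul, abs_of_pos (inv_pos.2 (h4.trans_le h3))]
      calc |A ω| * (e ω * gΔ ω)⁻¹ ≤ 1 * (cA * cΔ)⁻¹ :=
            mul_le_mul (hA1 ω) (inv_anti₀ h4 h3) (inv_pos.2 (h4.trans_le h3)).le zero_le_one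
        _ = _ := one_mul _)
  have treatment := integral_mul_mul_eq_integral_mul_condExp_mul hA hY1 hind hY1int
    (.of_forall hA1) (h := fun ω => (e ω)⁻¹) (C := cA⁻¹) hew.inv₀ (by
      filter_upwards [hepos] with ω h1
      rw [abs_of_pos (inv_pos.2 (hcA.trans_le h1.1))]
      exact inv_anti₀ hcA h1.1)
  calc ∫ ω, (A ω * Δ ω) / (e ω * gΔ ω) * Y ω ∂P
      = ∫ ω, A ω * (e ω * gΔ ω)⁻¹ * (Δ ω * Y ω) ∂P := by
        congr with ω; ring
    _ = ∫ ω, A ω * (e ω * gΔ ω)⁻¹ * (P[Δ | 𝔪] ω * Y ω) ∂P := censoring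
    _ = ∫ ω, (e ω)⁻¹ * (A ω * Y1 ω) ∂P := by
        refine integral_congr_ae ?_
        filter_upwards [hgΔ, hgΔpos] with ω h1 h2
        have h3 : gΔ ω ≠ 0 := (hcΔ.trans_le h2).ne'
        rw [← h1, ← hAY, mul_inv]
        field_simp
    _ = ∫ ω, (e ω)⁻¹ * (P[A | 𝔴] ω * Y1 ω) ∂P := treatment
    _ = ∫ ω, Y1 ω ∂P := by
        refine integral_congr_ae ?_
        filter_upwards [he, hepos] with ω h1 h2
        rw [← h1, inv_mul_cancel_left₀ (hcA.trans_le h2.1).ne']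
end

section
/- Bilinear structure of the treatment-boundary remainder R₂⁽²⁾ (second product in equation (10)): suppose cA ≤ e ≤ 1 − cA almost surely for some cA > 0, let F be a bounded σ(S, W)-measurable random variable, define m₀ := E[A·F | 𝔴] / e, and let m̂ and ĝ be bounded 𝔴-measurable random variables with ĝ ≥ c almost surely for some c > 0. Then E[(A / ĝ) · (F − m̂) + m̂ − m₀] = E[(m₀ − m̂) · (e / ĝ − 1)]; the error of the augmented treatment correction is exactly the bilinear product of the intermediate-regression error and the treatment-propensity ratio error. -/
open MeasureTheory ProbabilityTheory

/-- A bounded `m`-measurable factor only sees the conditional expectation given `m` of the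
other factor, under the integral. -/
theorem integral_mul_condExp_of_bound {Ω : Type*} {m mΩ : MeasurableSpace Ω} {μ : Measure Ω}
    [IsFiniteMeasure μ] (hm : m ≤ mΩ) {h X : Ω → ℝ} (hh : StronglyMeasurable[m] h)
    (hX : Integrable X μ) (C : ℝ) (hC : ∀ᵐ ω ∂μ, ‖h ω‖ ≤ C) :
    ∫ ω, h ω * (μ[X | m]) ω ∂μ = ∫ ω, h ω * X ω ∂μ := by
  have key := condExp_stronglyMeasurable_mul_of_bound hm hh hX C hC
  calc ∫ ω, h ω * (μ[X | m]) ω ∂μ = ∫ ω, (μ[h * X | m]) ω ∂μ := (integral_congr_ae key).symm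
    _ = ∫ ω, h ω * X ω ∂μ := integral_condExp hm

/-- **Bilinear structure of the treatment-boundary remainder `R₂⁽²⁾`** (second product
in equation (10)).  With `𝔴 := σ(W)` and `e` a version of `E[A | 𝔴]` with
`cA ≤ e ≤ 1 − cA` a.s., let `F` be a bounded `σ(S, W)`-measurable random variable,
`m₀ := E[A·F | 𝔴] / e`, and let `m̂`, `ĝ` be bounded `𝔴`-measurable random variables
with `ĝ ≥ c > 0` a.s.  Then
`E[(A / ĝ)·(F − m̂) + m̂ − m₀] = E[(m₀ − m̂)·(e / ĝ − 1)]`: the error of the augmented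
treatment correction is exactly the bilinear product of the intermediate-regression
error and the treatment-propensity ratio error. -/
theorem treatment_remainder_bilinear
    {Ω : Type*} [mΩ : MeasurableSpace Ω]
    {P : Measure Ω} [IsProbabilityMeasure P] {p : ℕ}
    (W : Ω → (Fin p → ℝ)) (A S : Ω → ℝ)
    (hW : Measurable W) (hA : Measurable A) (hS : Measurable S)
    (hA01 : ∀ ω, A ω = 0 ∨ A ω = 1)
    (𝔴 : MeasurableSpace Ω)
    (h𝔴 : 𝔴 = MeasurableSpace.comap W inferInstance)
    (h𝔴le : 𝔴 ≤ mΩ)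
    (e : Ω → ℝ) (he : e =ᵐ[P] P[A | 𝔴])
    (cA : ℝ) (hcA : 0 < cA) (hepos : ∀ᵐ ω ∂P, cA ≤ e ω ∧ e ω ≤ 1 - cA)
    (F : Ω → ℝ)
    (hFmeas : Measurable[MeasurableSpace.comap (fun ω => (S ω, W ω)) inferInstance] F)
    (CF : ℝ) (hFbd : ∀ ω, |F ω| ≤ CF)
    (m₀ : Ω → ℝ) (hm₀ : m₀ = fun ω => (P[fun ω' => A ω' * F ω' | 𝔴]) ω / e ω)
    (mhat : Ω → ℝ) (hmhatmeas : Measurable[𝔴] mhat)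
    (Cm : ℝ) (hmhatbd : ∀ ω, |mhat ω| ≤ Cm)
    (ghat : Ω → ℝ) (hghatmeas : Measurable[𝔴] ghat)
    (Cg : ℝ) (hghatbd : ∀ ω, |ghat ω| ≤ Cg)
    (c : ℝ) (hc : 0 < c) (hghatpos : ∀ᵐ ω ∂P, c ≤ ghat ω) :
    ∫ ω, (A ω / ghat ω) * (F ω - mhat ω) + mhat ω - m₀ ω ∂P
      = ∫ ω, (m₀ ω - mhat ω) * (e ω / ghat ω - 1) ∂P := by
  have hF : Measurable[mΩ] F := hFmeas.mono (hS.prodMk hW).comap_le le_rfl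
  have hAint : Integrable A P := by
    refine Integrable.of_bound hA.aestronglyMeasurable 1 (.of_forall fun ω => ?_)
    rcases hA01 ω with h | h <;> simp [h]
  have hAF : Integrable (fun ω => A ω * F ω) P :=
    hAint.mul_bdd (c := CF) hF.aestronglyMeasurable (.of_forall hFbd)
  have hginv_meas : StronglyMeasurable[𝔴] (fun ω => (ghat ω)⁻¹) := hghatmeas.inv.stronglyMeasurable
  have hginv_bd : ∀ᵐ ω ∂P, ‖(ghat ω)⁻¹‖ ≤ c⁻¹ := by
    filter_upwards [hghatpos] with ω hω
    rw [Real.norm_eq_abs, abs_of_pos (inv_pos.2 (hc.trans_le hω))]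
    exact inv_anti₀ hc hω
  have hq_meas : StronglyMeasurable[𝔴] (fun ω => (ghat ω)⁻¹ * mhat ω) :=
    hginv_meas.mul hmhatmeas.stronglyMeasurable
  have hq_bd : ∀ᵐ ω ∂P, ‖(ghat ω)⁻¹ * mhat ω‖ ≤ c⁻¹ * Cm := by
    filter_upwards [hginv_bd] with ω hω
    rw [norm_mul]
    exact mul_le_mul hω (hmhatbd ω) (norm_nonneg _) (inv_nonneg.2 hc.le)
  have hmhat_int : Integrable mhat P :=
    Integrable.of_bound (hmhatmeas.mono h𝔴le le_rfl).aestronglyMeasurable Cm (.of_forall hmhatbd)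
  have he_meas : AEStronglyMeasurable[mΩ] e P :=
    (integrable_condExp (m := 𝔴) (f := A) (μ := P)).aestronglyMeasurable.congr he.symm
  have hm₀_int : Integrable m₀ P := by
    rw [hm₀]
    simp only [div_eq_mul_inv]
    refine integrable_condExp.mul_bdd (c := cA⁻¹) he_meas.aemeasurable.inv.aestronglyMeasurable ?_
    filter_upwards [hepos] with ω hω
    rw [Real.norm_eq_abs, abs_of_pos (inv_pos.2 (hcA.trans_le hω.1))]
    exact inv_anti₀ hcA hω.1
  have hd_int : Integrable (fun ω => mhat ω - m₀ ω) P := hmhat_int.sub hm₀_int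
  have hg_ae := (hginv_meas.mono h𝔴le).aestronglyMeasurable (μ := P)
  have hq_ae := (hq_meas.mono h𝔴le).aestronglyMeasurable (μ := P)
  have i₁ := hAF.bdd_mul hg_ae hginv_bd
  have i₂ := hAint.bdd_mul hq_ae hq_bd
  have j₁ := (integrable_condExp (m := 𝔴) (f := fun ω => A ω * F ω) (μ := P)).bdd_mul
    hg_ae hginv_bd
  have j₂ := (integrable_condExp (m := 𝔴) (f := A) (μ := P)).bdd_mul hq_ae hq_bd
  calc ∫ ω, (A ω / ghat ω) * (F ω - mhat ω) + mhat ω - m₀ ω ∂P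
      = ∫ ω, ((ghat ω)⁻¹ * (A ω * F ω) - ((ghat ω)⁻¹ * mhat ω) * A ω)
          + (mhat ω - m₀ ω) ∂P := by
        congr 1 with ω
        ring
    _ = ∫ ω, ((ghat ω)⁻¹ * (P[fun ω' => A ω' * F ω' | 𝔴]) ω
          - ((ghat ω)⁻¹ * mhat ω) * (P[A | 𝔴]) ω) + (mhat ω - m₀ ω) ∂P := by
        rw [integral_add (i₁.sub' i₂) hd_int, integral_add (j₁.sub' j₂) hd_int,
          integral_sub i₁ i₂, integral_sub j₁ j₂,
          integral_mul_condExp_of_bound h𝔴le hginv_meas hAF _ hginv_bd,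
          integral_mul_condExp_of_bound h𝔴le hq_meas hAint _ hq_bd]
    _ = ∫ ω, (m₀ ω - mhat ω) * (e ω / ghat ω - 1) ∂P := by
        refine integral_congr_ae ?_
        filter_upwards [he, hepos] with ω h₁ h₂
        have hne : e ω ≠ 0 := (hcA.trans_le h₂.1).ne'
        have hm : (P[fun ω' => A ω' * F ω' | 𝔴]) ω = m₀ ω * e ω := by
          rw [hm₀]
          exact (div_mul_cancel₀ _ hne).symm
        rw [hm, ← h₁]
        ring
end

section
/- Mean-zero representation of the full efficient influence function at the true nuisance values: under consistency, ignorability, surrogate-mediated MAR, treatment positivity, and censoring support positivity, define m₁ := E[A·Q̄ | 𝔴] / e and m₀ := E[(1−A)·Q̄ | 𝔴] / (1 − e). Then E[ (A·Δ)/(e·gΔ)·(Y − Q̄) + (A/e)·(Q̄ − m₁) + m₁ − ((1−A)·Δ)/((1−e)·gΔ)·(Y − Q̄) − ((1−A)/(1−e))·(Q̄ − m₀) − m₀ ] = E[Y(1) − Y(0)]; equivalently, the efficient influence function D* (the above expression minus the average treatment effect) has expectation zero. -/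
open MeasureTheory ProbabilityTheory

/-- The conditional expectation of a product of conditionally independent variables is the product
of the conditional expectations. -/
lemma condExp_mul_eq_mul_of_condIndepFun {Ω : Type*} {m mΩ : MeasurableSpace Ω}
    [StandardBorelSpace Ω] {P : Measure Ω} [IsFiniteMeasure P] (hm : m ≤ mΩ) {X Y : Ω → ℝ}
    (hX : Measurable X) (hY : Measurable Y) (hXint : Integrable X P) (hYint : Integrable Y P)
    (hXYint : Integrable (X * Y) P) (h : CondIndepFun m hm X Y P) :
    P[X * Y | m] =ᵐ[P] P[X | m] * P[Y | m] := by
  have hker := ae_of_ae_trim hm ((condIndepFun_iff_map_prod_eq_prod_map_map hX hY).1 h)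
  filter_upwards [hker, condExp_ae_eq_integral_condExpKernel hm hXint,
    condExp_ae_eq_integral_condExpKernel hm hYint,
    condExp_ae_eq_integral_condExpKernel hm hXYint] with ω hω hXω hYω hXYω
  have hindep : IndepFun X Y (condExpKernel P m ω) := by
    rw [indepFun_iff_map_prod_eq_prod_map_map hX.aemeasurable hY.aemeasurable]
    rwa [Kernel.map_apply _ (by fun_prop), Kernel.prod_apply, Kernel.map_apply _ hX,
      Kernel.map_apply _ hY] at hω
  rw [hXYω, Pi.mul_apply, hXω, hYω]
  exact hindep.integral_mul_eq_mul_integral hX.aestronglyMeasurable hY.aestronglyMeasurable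

/-- A variable with vanishing conditional expectation is orthogonal to every bounded variable
measurable with respect to the conditioning σ-algebra. -/
lemma integrable_mul_and_integral_mul_eq_zero {Ω : Type*} {m mΩ : MeasurableSpace Ω}
    {P : Measure Ω} [IsFiniteMeasure P] (hm : m ≤ mΩ) {H Z : Ω → ℝ} {c : ℝ}
    (hH : AEStronglyMeasurable[m] H P) (hHc : ∀ᵐ ω ∂P, ‖H ω‖ ≤ c)
    (hZ : Integrable Z P) (hZ0 : P[Z | m] =ᵐ[P] 0) :
    Integrable (H * Z) P ∧ ∫ ω, (H * Z) ω ∂P = 0 := by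
  refine ⟨hZ.bdd_mul (hH.mono hm) hHc, ?_⟩
  have hHZ : P[H * Z | m] =ᵐ[P] 0 := by
    filter_upwards [condExp_stronglyMeasurable_mul_of_bound₀ hm hH hZ c hHc, hZ0] with ω h h0
    simp [h, h0]
  rw [← integral_condExp hm, integral_congr_ae hHZ]
  simp

/-- Multiplying an integrable variable by an indicator preserves integrability. -/
lemma MeasureTheory.Integrable.indicator_valued_mul {Ω : Type*} {mΩ : MeasurableSpace Ω}
    {P : Measure Ω} {B X : Ω → ℝ} (hX : Integrable X P) (hB : AEStronglyMeasurable B P)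
    (hB01 : ∀ ω, B ω = 0 ∨ B ω = 1) : Integrable (B * X) P :=
  hX.bdd_mul (c := 1) hB (.of_forall fun ω => by rcases hB01 ω with h | h <;> simp [h])

/-- An indicator-valued measurable variable is integrable for a finite measure. -/
lemma MeasureTheory.Integrable.of_indicator_valued {Ω : Type*} {mΩ : MeasurableSpace Ω}
    {P : Measure Ω} [IsFiniteMeasure P] {B : Ω → ℝ} (hB : AEStronglyMeasurable B P)
    (hB01 : ∀ ω, B ω = 0 ∨ B ω = 1) : Integrable B P :=
  .of_bound hB 1 (.of_forall fun ω => by rcases hB01 ω with h | h <;> simp [h])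

/-- The augmented inverse probability weighted variable of the arm with indicator `B` and
potential outcome `T` is integrable with mean `E[T]`. -/
lemma integrable_and_integral_arm_eq {Ω : Type*} {𝔪 𝔴 mΩ : MeasurableSpace Ω}
    {P : Measure Ω} [IsFiniteMeasure P] (h𝔴𝔪 : 𝔴 ≤ 𝔪) (h𝔪 : 𝔪 ≤ mΩ)
    {B Δ Y T Q π g μ : Ω → ℝ} {c d : ℝ}
    (hB : StronglyMeasurable[𝔪] B) (hB01 : ∀ ω, B ω = 0 ∨ B ω = 1)
    (hΔ : Measurable Δ) (hΔ01 : ∀ ω, Δ ω = 0 ∨ Δ ω = 1)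
    (hY : Integrable Y P) (hcons : B * Y = B * T)
    (hign : P[B * T | 𝔴] =ᵐ[P] P[B | 𝔴] * P[T | 𝔴])
    (hMAR : P[Δ * Y | 𝔪] =ᵐ[P] P[Δ | 𝔪] * P[Y | 𝔪])
    (hg : g =ᵐ[P] P[Δ | 𝔪]) (hd : 0 < d) (hgd : ∀ᵐ ω ∂P, d ≤ g ω)
    (hπ : π =ᵐ[P] P[B | 𝔴]) (hc : 0 < c) (hπc : ∀ᵐ ω ∂P, c ≤ π ω)
    (hQ : Q = fun ω => (P[fun ω' => Δ ω' * Y ω' | 𝔪]) ω / g ω)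
    (hμ : μ = fun ω => (P[fun ω' => B ω' * Q ω' | 𝔴]) ω / π ω) :
    Integrable (fun ω => (B ω * Δ ω) / (π ω * g ω) * (Y ω - Q ω)
        + (B ω / π ω) * (Q ω - μ ω) + μ ω) P ∧
      ∫ ω, (B ω * Δ ω) / (π ω * g ω) * (Y ω - Q ω)
        + (B ω / π ω) * (Q ω - μ ω) + μ ω ∂P = ∫ ω, T ω ∂P := by
  have h𝔴 : 𝔴 ≤ mΩ := h𝔴𝔪.trans h𝔪
  have hBm : AEStronglyMeasurable B P := (hB.mono h𝔪).aestronglyMeasurable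
  have hΔm : AEStronglyMeasurable Δ P := hΔ.aestronglyMeasurable
  have hBint := Integrable.of_indicator_valued hBm hB01
  have hΔint := Integrable.of_indicator_valued hΔm hΔ01
  have hQY : Q =ᵐ[P] P[Y | 𝔪] := by
    filter_upwards [hMAR, hg, hgd] with ω h1 h2 h3
    have h1' : (P[fun ω' => Δ ω' * Y ω' | 𝔪]) ω = P[Δ | 𝔪] ω * P[Y | 𝔪] ω := h1
    simp only [hQ]
    rw [h1', ← h2]
    field_simp [(hd.trans_le h3).ne']
  have hQint : Integrable Q P := integrable_condExp.congr hQY.symm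
  have hQ𝔪 : AEStronglyMeasurable[𝔪] Q P :=
    stronglyMeasurable_condExp.aestronglyMeasurable.congr hQY.symm
  have hBQint : Integrable (B * Q) P := hQint.indicator_valued_mul hBm hB01
  have hBY : P[B * Q | 𝔴] =ᵐ[P] P[B | 𝔴] * P[T | 𝔴] := by
    have h1 : P[B * Y | 𝔪] =ᵐ[P] B * Q := by
      filter_upwards [condExp_mul_of_stronglyMeasurable_left hB
        (hY.indicator_valued_mul hBm hB01) hY, hQY] with ω h h'
      simp [h, h']
    calc P[B * Q | 𝔴] =ᵐ[P] P[P[B * Y | 𝔪] | 𝔴] := condExp_congr_ae h1.symm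
      _ =ᵐ[P] P[B * Y | 𝔴] := condExp_condExp_of_le h𝔴𝔪 h𝔪
      _ =ᵐ[P] P[B | 𝔴] * P[T | 𝔴] := by rw [hcons]; exact hign
  have hμT : μ =ᵐ[P] P[T | 𝔴] := by
    filter_upwards [hBY, hπ, hπc] with ω h1 h2 h3
    have h1' : (P[fun ω' => B ω' * Q ω' | 𝔴]) ω = P[B | 𝔴] ω * P[T | 𝔴] ω := h1
    simp only [hμ]
    rw [h1', ← h2]
    field_simp [(hc.trans_le h3).ne']
  have hμint : Integrable μ P := integrable_condExp.congr hμT.symm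
  have hμ𝔴 : AEStronglyMeasurable[𝔴] μ P :=
    stronglyMeasurable_condExp.aestronglyMeasurable.congr hμT.symm
  have hπ𝔴 : AEStronglyMeasurable[𝔴] π P :=
    stronglyMeasurable_condExp.aestronglyMeasurable.congr hπ.symm
  have hg𝔪 : AEStronglyMeasurable[𝔪] g P :=
    stronglyMeasurable_condExp.aestronglyMeasurable.congr hg.symm
  obtain ⟨hI1, hE1⟩ := integrable_mul_and_integral_mul_eq_zero h𝔪
    (H := fun ω => B ω * ((π ω)⁻¹ * (g ω)⁻¹)) (Z := Δ * Y - Δ * Q) (c := c⁻¹ * d⁻¹)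
    (hB.aestronglyMeasurable.mul ((hπ𝔴.mono h𝔴𝔪).inv₀.mul hg𝔪.inv₀))
    (by
      filter_upwards [hπc, hgd] with ω h1 h2
      have hg0 : 0 < g ω := hd.trans_le h2
      have hbd : ‖(π ω)⁻¹ * (g ω)⁻¹‖ ≤ c⁻¹ * d⁻¹ := by
        rw [norm_mul, norm_inv, norm_inv, Real.norm_of_nonneg (hc.le.trans h1),
          Real.norm_of_nonneg (hd.le.trans h2)]
        gcongr
      rcases hB01 ω with h | h
      · simp only [h, zero_mul, norm_zero]; positivity
      · simpa only [h, one_mul] using hbd)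
    ((hY.indicator_valued_mul hΔm hΔ01).sub (hQint.indicator_valued_mul hΔm hΔ01))
    (by
      filter_upwards [condExp_sub (hY.indicator_valued_mul hΔm hΔ01)
          (hQint.indicator_valued_mul hΔm hΔ01) 𝔪, hMAR, hQY,
        condExp_mul_of_aestronglyMeasurable_right hQ𝔪
          (hQint.indicator_valued_mul hΔm hΔ01) hΔint] with ω h1 h2 h3 h4
      simp [h1, h2, h3, h4])
  have hBμint : Integrable (B * μ) P := hμint.indicator_valued_mul hBm hB01
  obtain ⟨hI2, hE2⟩ := integrable_mul_and_integral_mul_eq_zero h𝔴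
    (H := fun ω => (π ω)⁻¹) (Z := B * Q - B * μ) (c := c⁻¹) hπ𝔴.inv₀
    (by
      filter_upwards [hπc] with ω h1
      rw [norm_inv, Real.norm_of_nonneg (hc.le.trans h1)]
      gcongr)
    (hBQint.sub hBμint)
    (by
      filter_upwards [condExp_sub hBQint hBμint 𝔴, hBY, hμT,
        condExp_mul_of_aestronglyMeasurable_right hμ𝔴 hBμint hBint] with ω h1 h2 h3 h4
      simp [h1, h2, h3, h4])
  have hφ : (fun ω => (B ω * Δ ω) / (π ω * g ω) * (Y ω - Q ω)
      + (B ω / π ω) * (Q ω - μ ω) + μ ω) =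
      (fun ω => B ω * ((π ω)⁻¹ * (g ω)⁻¹)) * (Δ * Y - Δ * Q)
        + (fun ω => (π ω)⁻¹) * (B * Q - B * μ) + μ := by
    ext ω
    simp only [Pi.add_apply, Pi.mul_apply, Pi.sub_apply, div_eq_mul_inv, mul_inv]
    ring
  rw [hφ]
  refine ⟨(hI1.add hI2).add hμint, ?_⟩
  rw [integral_add' (hI1.add hI2) hμint, integral_add' hI1 hI2, hE1, hE2,
    integral_congr_ae hμT, integral_condExp h𝔴]
  simp

/-- **Mean-zero representation of the full efficient influence function at the true
nuisance values.**  With `𝔪 := σ(S, A, W)`, `𝔴 := σ(W)`, `gΔ` a version of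
`E[Δ | 𝔪]`, `e` a version of `E[A | 𝔴]`, `Q̄ := E[Δ·Y | 𝔪] / gΔ`,
`m₁ := E[A·Q̄ | 𝔴] / e` and `m₀ := E[(1−A)·Q̄ | 𝔴] / (1 − e)`, under consistency,
ignorability, surrogate-mediated MAR, treatment positivity and censoring support
positivity,
`E[(A·Δ)/(e·gΔ)·(Y − Q̄) + (A/e)·(Q̄ − m₁) + m₁
  − ((1−A)·Δ)/((1−e)·gΔ)·(Y − Q̄) − ((1−A)/(1−e))·(Q̄ − m₀) − m₀] = E[Y(1) − Y(0)]`;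
equivalently, the efficient influence function `D*` (the above expression minus the
average treatment effect) has expectation zero. -/
theorem EIF_mean_zero
    {Ω : Type*} [mΩ : MeasurableSpace Ω] [StandardBorelSpace Ω]
    {P : Measure Ω} [IsProbabilityMeasure P] {p : ℕ}
    (W : Ω → (Fin p → ℝ)) (A S Δ Y Y0 Y1 : Ω → ℝ)
    (hW : Measurable W) (hA : Measurable A) (hS : Measurable S)
    (hΔ : Measurable Δ) (hY : Measurable Y)
    (hY0 : Measurable Y0) (hY1 : Measurable Y1)
    (hA01 : ∀ ω, A ω = 0 ∨ A ω = 1) (hΔ01 : ∀ ω, Δ ω = 0 ∨ Δ ω = 1)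
    (𝔪 𝔴 : MeasurableSpace Ω)
    (h𝔪 : 𝔪 = MeasurableSpace.comap (fun ω => (S ω, A ω, W ω)) inferInstance)
    (h𝔴 : 𝔴 = MeasurableSpace.comap W inferInstance)
    (h𝔪le : 𝔪 ≤ mΩ) (h𝔴le : 𝔴 ≤ mΩ)
    -- consistency
    (hcons : ∀ ω, Y ω = A ω * Y1 ω + (1 - A ω) * Y0 ω)
    -- ignorability
    (hign : CondIndepFun 𝔴 h𝔴le A (fun ω => (Y0 ω, Y1 ω)) P)
    -- surrogate-mediated MAR
    (hMAR : CondIndepFun 𝔪 h𝔪le Δ Y P)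
    (hY0int : Integrable Y0 P) (hY1int : Integrable Y1 P) (hYint : Integrable Y P)
    (gΔ : Ω → ℝ) (hgΔ : gΔ =ᵐ[P] P[Δ | 𝔪])
    (e : Ω → ℝ) (he : e =ᵐ[P] P[A | 𝔴])
    -- treatment positivity
    (cA : ℝ) (hcA : 0 < cA) (hepos : ∀ᵐ ω ∂P, cA ≤ e ω ∧ e ω ≤ 1 - cA)
    -- censoring support positivity
    (cΔ : ℝ) (hcΔ : 0 < cΔ) (hgΔpos : ∀ᵐ ω ∂P, cΔ ≤ gΔ ω)
    -- the true nuisance regressions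
    (Qbar : Ω → ℝ) (hQbar : Qbar = fun ω => (P[fun ω' => Δ ω' * Y ω' | 𝔪]) ω / gΔ ω)
    (m₁ : Ω → ℝ) (hm₁ : m₁ = fun ω => (P[fun ω' => A ω' * Qbar ω' | 𝔴]) ω / e ω)
    (m₀ : Ω → ℝ)
    (hm₀ : m₀ = fun ω => (P[fun ω' => (1 - A ω') * Qbar ω' | 𝔴]) ω / (1 - e ω)) :
    ∫ ω, (A ω * Δ ω) / (e ω * gΔ ω) * (Y ω - Qbar ω)
        + (A ω / e ω) * (Qbar ω - m₁ ω) + m₁ ω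
        - ((1 - A ω) * Δ ω) / ((1 - e ω) * gΔ ω) * (Y ω - Qbar ω)
        - ((1 - A ω) / (1 - e ω)) * (Qbar ω - m₀ ω) - m₀ ω ∂P
      = ∫ ω, Y1 ω - Y0 ω ∂P := by
  have h𝔴𝔪 : 𝔴 ≤ 𝔪 := by
    have hle : MeasurableSpace.comap (fun ω => (S ω, A ω, W ω)) inferInstance ≤ 𝔪 := h𝔪.ge
    rw [h𝔴, ← measurable_iff_comap_le]
    exact measurable_snd.comp (measurable_snd.comp (measurable_iff_comap_le.2 hle))
  have hA𝔪 : StronglyMeasurable[𝔪] A := by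
    have hle : MeasurableSpace.comap (fun ω => (S ω, A ω, W ω)) inferInstance ≤ 𝔪 := h𝔪.ge
    exact (measurable_fst.comp
      (measurable_snd.comp (measurable_iff_comap_le.2 hle))).stronglyMeasurable
  have hA𝔪' : StronglyMeasurable[𝔪] (1 - A) := stronglyMeasurable_one.sub hA𝔪
  have hA01' : ∀ ω, (1 - A) ω = 0 ∨ (1 - A) ω = 1 := fun ω => by
    rcases hA01 ω with h | h <;> simp [h]
  have hAint : Integrable A P := .of_indicator_valued hA.aestronglyMeasurable hA01
  have hA' : Measurable[mΩ] (1 - A) := measurable_const.sub hA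
  have hAint' : Integrable (1 - A) P := .of_indicator_valued hA'.aestronglyMeasurable hA01'
  have hMAR' : P[Δ * Y | 𝔪] =ᵐ[P] P[Δ | 𝔪] * P[Y | 𝔪] :=
    condExp_mul_eq_mul_of_condIndepFun h𝔪le hΔ hY
      (.of_indicator_valued hΔ.aestronglyMeasurable hΔ01) hYint
      (hYint.indicator_valued_mul hΔ.aestronglyMeasurable hΔ01) hMAR
  have hign1 : P[A * Y1 | 𝔴] =ᵐ[P] P[A | 𝔴] * P[Y1 | 𝔴] :=
    condExp_mul_eq_mul_of_condIndepFun h𝔴le hA hY1 hAint hY1int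
      (hY1int.indicator_valued_mul hA.aestronglyMeasurable hA01)
      (hign.comp measurable_id measurable_snd)
  have hign0 : P[(1 - A) * Y0 | 𝔴] =ᵐ[P] P[1 - A | 𝔴] * P[Y0 | 𝔴] :=
    condExp_mul_eq_mul_of_condIndepFun h𝔴le hA' hY0 hAint' hY0int
      (hY0int.indicator_valued_mul hA'.aestronglyMeasurable hA01')
      (hign.comp (measurable_const.sub measurable_id : Measurable fun x : ℝ => 1 - x)
        measurable_fst)
  have hcons1 : A * Y = A * Y1 := by
    ext ω
    rcases hA01 ω with h | h <;> simp [hcons ω, h]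
  have hcons0 : (1 - A) * Y = (1 - A) * Y0 := by
    ext ω
    rcases hA01 ω with h | h <;> simp [hcons ω, h]
  have he' : (fun ω => 1 - e ω) =ᵐ[P] P[1 - A | 𝔴] := by
    have hone : P[(1 : Ω → ℝ) | 𝔴] = 1 := condExp_const h𝔴le (1 : ℝ)
    have hsub : P[1 - A | 𝔴] =ᵐ[P] P[(1 : Ω → ℝ) | 𝔴] - P[A | 𝔴] :=
      condExp_sub (integrable_const (1 : ℝ)) hAint 𝔴
    filter_upwards [he, hsub] with ω h1 h2
    simp [h1, h2, hone]
  obtain ⟨hI1, hE1⟩ := integrable_and_integral_arm_eq h𝔴𝔪 h𝔪le hA𝔪 hA01 hΔ hΔ01 hYint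
    hcons1 hign1 hMAR' hgΔ hcΔ hgΔpos he hcA (hepos.mono fun _ h => h.1) hQbar hm₁
  obtain ⟨hI0, hE0⟩ := integrable_and_integral_arm_eq h𝔴𝔪 h𝔪le hA𝔪' hA01' hΔ hΔ01 hYint
    hcons0 hign0 hMAR' hgΔ hcΔ hgΔpos he' hcA (hepos.mono fun _ h => by linarith [h.2]) hQbar hm₀
  rw [integral_sub hY1int hY0int, ← hE1, ← hE0, ← integral_sub hI1 hI0]
  refine integral_congr_ae (.of_forall fun ω => ?_)
  simp only [Pi.sub_apply, Pi.one_apply]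
  ring
end
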